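/- arXiv:2409.04784 — 7 statements merged into one kernel-verified Lean document; each statement's English description precedes it below -/
import Mathlib

section
/- Let E be the Euclidean space ℝⁿ with inner product ⟪·,·⟫ and norm ‖·‖. Let g ∈ E, let H : E → E be a continuous linear map with operator norm ‖H‖, let σ > 0, f₀ ∈ ℝ, and define the cubic regularization model m(t) := f₀ + ⟪g, t⟫ + (1/2)⟪t, H t⟫ + (σ/3)‖t‖³. If t* ∈ E satisfies m(t*) ≤ m(−β g) for every real β ≥ 0 (i.e. t* is at least as good as the best Cauchy point), then f₀ − m(t*) ≥ (‖g‖/(6·√2)) · min( ‖g‖/(1 + ‖H‖), (1/2)·√(‖g‖/σ) ). -/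
open RealInnerProductSpace

/-- Lemma 3.1 (Cauchy-point decrease for the tangential ARC subproblem). -/
theorem cauchy_point_decrease (n : ℕ) (g : EuclideanSpace ℝ (Fin n))
    (H : EuclideanSpace ℝ (Fin n) →L[ℝ] EuclideanSpace ℝ (Fin n))
    (σ f₀ : ℝ) (hσ : 0 < σ)
    (m : EuclideanSpace ℝ (Fin n) → ℝ)
    (hm : ∀ t, m t = f₀ + ⟪g, t⟫ + (1/2) * ⟪t, H t⟫ + (σ/3) * ‖t‖^3)
    (tstar : EuclideanSpace ℝ (Fin n))
    (hts : ∀ β : ℝ, 0 ≤ β → m tstar ≤ m (-β • g)) :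
    f₀ - m tstar ≥ (‖g‖ / (6 * Real.sqrt 2)) *
      min (‖g‖ / (1 + ‖H‖)) ((1/2) * Real.sqrt (‖g‖ / σ)) := by
  have hH := norm_nonneg H
  set M := min (‖g‖ / (1 + ‖H‖)) ((1/2) * Real.sqrt (‖g‖ / σ)) with hM
  have hM0 : 0 ≤ M := by positivity
  have hcoeff : ‖g‖ / (6 * Real.sqrt 2) * M ≤ ‖g‖ / 6 * M := by
    have h1 : (1 : ℝ) ≤ Real.sqrt 2 := Real.one_le_sqrt.mpr (by norm_num)
    gcongr
    linarith
  rcases (norm_nonneg g).eq_or_lt with hg | hg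
  · have h0 := hts 0 le_rfl
    rw [hm (-0 • g)] at h0
    simp at h0
    rw [← hg] at hcoeff ⊢
    simpa using h0
  have hMH : M * (1 + ‖H‖) ≤ ‖g‖ :=
    (le_div_iff₀ (by positivity)).mp (min_le_left _ _)
  have hMσ : σ * M ^ 2 ≤ ‖g‖ / 4 := by
    have h1 : M ^ 2 ≤ ((1/2) * Real.sqrt (‖g‖ / σ)) ^ 2 :=
      pow_le_pow_left₀ hM0 (min_le_right _ _) 2
    rw [mul_pow, Real.sq_sqrt (by positivity)] at h1
    calc σ * M ^ 2 ≤ σ * ((1/2) ^ 2 * (‖g‖ / σ)) := by gcongr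
      _ = ‖g‖ / 4 := by field_simp; norm_num
  have hβ : 0 ≤ M / ‖g‖ := by positivity
  have hdec := hts (M / ‖g‖) hβ
  set t := -(M / ‖g‖) • g with ht
  have hnorm : ‖t‖ = M := by
    rw [ht, norm_smul, norm_neg, Real.norm_of_nonneg hβ]
    field_simp
  have hlin : ⟪g, t⟫ = -(M * ‖g‖) := by
    rw [ht, inner_smul_right, real_inner_self_eq_norm_sq]
    field_simp
  have hquad : ⟪t, H t⟫ ≤ M * (‖H‖ * M) := by
    calc ⟪t, H t⟫ ≤ ‖t‖ * ‖H t‖ := real_inner_le_norm _ _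
      _ ≤ ‖t‖ * (‖H‖ * ‖t‖) := by gcongr; exact H.le_opNorm t
      _ = M * (‖H‖ * M) := by rw [hnorm]
  rw [hm t, hlin, hnorm] at hdec
  have h1 : M * (M * (1 + ‖H‖)) ≤ M * ‖g‖ := by gcongr
  have h2 : M * (σ * M ^ 2) ≤ M * (‖g‖ / 4) := by gcongr
  nlinarith [mul_nonneg hM0 hM0, mul_nonneg hM0 hg.le]
end

section
/- Let E be the Euclidean space ℝⁿ with inner product ⟪·,·⟫ and norm ‖·‖. Let g ∈ E, let H : E → E be a continuous linear map, let σ > 0, and let t ∈ E satisfy ⟪t, H t⟫ ≥ 0 and ⟪g, t⟫ + (1/2)⟪t, H t⟫ + (σ/3)‖t‖³ ≤ 0. Then ‖t‖ ≤ √3 · √(‖g‖/σ). -/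
open RealInnerProductSpace

/-- Lemma 3.2: bound on the tangential step. -/
theorem tangential_step_bound (n : ℕ) (g : EuclideanSpace ℝ (Fin n))
    (H : EuclideanSpace ℝ (Fin n) →L[ℝ] EuclideanSpace ℝ (Fin n))
    (σ : ℝ) (hσ : 0 < σ) (t : EuclideanSpace ℝ (Fin n))
    (hpsd : 0 ≤ ⟪t, H t⟫)
    (hdec : ⟪g, t⟫ + (1/2) * ⟪t, H t⟫ + (σ/3) * ‖t‖^3 ≤ 0) :
    ‖t‖ ≤ Real.sqrt 3 * Real.sqrt (‖g‖ / σ) := by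
  rw [← Real.sqrt_mul (by norm_num)]
  apply Real.le_sqrt_of_sq_le
  rw [← mul_div_assoc, le_div_iff₀ hσ]
  obtain ht | ht := (norm_nonneg t).eq_or_lt
  · rw [← ht]
    simp
  · have hcs : -(‖g‖ * ‖t‖) ≤ ⟪g, t⟫ := neg_le_of_abs_le (abs_real_inner_le_norm g t)
    refine le_of_mul_le_mul_right ?_ ht
    linarith
end

section
/- Let γ_h ∈ (0,1) and γ_ℓ ∈ (0,1). Let (h_k)_{k∈ℕ} and (ℓ_k)_{k∈ℕ} be real sequences such that 0 ≤ h_k ≤ h_max for all k, ℓ_k ≥ ℓ_min for all k (for some constants h_max and ℓ_min), and such that for all indices j < k at least one of the following holds: h_k ≤ (1 − γ_h)·h_j, or ℓ_k ≤ ℓ_j − γ_ℓ·h_j. Then there exists a subsequence (h_{k_i}) with lim_{i→∞} h_{k_i} = 0; in particular, inf_k h_k = 0 or the infimum limit of h_k is 0. -/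
open Filter

/-- Lemma 3.4 (after Fletcher–Leyffer–Toint): if infinitely many pairs are added to the
filter, a subsequence of the constraint violations tends to zero. -/
theorem filter_subsequence_tendsto_zero
    (γh γℓ : ℝ) (hγh : γh ∈ Set.Ioo (0:ℝ) 1) (hγℓ : γℓ ∈ Set.Ioo (0:ℝ) 1)
    (h ℓ : ℕ → ℝ) (hmax ℓmin : ℝ)
    (hh : ∀ k, 0 ≤ h k ∧ h k ≤ hmax)
    (hℓ : ∀ k, ℓmin ≤ ℓ k)
    (hfilter : ∀ j k : ℕ, j < k →
      h k ≤ (1 - γh) * h j ∨ ℓ k ≤ ℓ j - γℓ * h j) :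
    ∃ φ : ℕ → ℕ, StrictMono φ ∧
      Tendsto (fun i => h (φ i)) atTop (nhds 0) := by
  obtain ⟨hγ0, hγ1⟩ := hγh
  obtain ⟨L, hL, φ, hφ, hlim⟩ := isCompact_Icc.tendsto_subseq (x := h) (s := Set.Icc 0 hmax) hh
  suffices hL0 : L = 0 from ⟨φ, hφ, hL0 ▸ hlim⟩
  by_contra hne
  have hLpos : 0 < L := lt_of_le_of_ne hL.1 (Ne.symm hne)
  have hγL : 0 < γh * L := mul_pos hγ0 hLpos
  have hlower : ∀ᶠ i in atTop, L - γh * L / 2 < h (φ i) :=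
    hlim.eventually_const_lt (by linarith)
  have hupper : ∀ᶠ i in atTop, h (φ i) < L + γh * L / 2 :=
    hlim.eventually_lt_const (by linarith)
  obtain ⟨M, hM⟩ := eventually_atTop.1 (hlower.and hupper)
  have hδ : 0 < γℓ * (L / 2) := mul_pos hγℓ.1 (half_pos hLpos)
  have hstep : ∀ i, M ≤ i → ℓ (φ (i + 1)) ≤ ℓ (φ i) - γℓ * (L / 2) := by
    intro i hi
    obtain ⟨hlo, hup⟩ := hM i hi
    have hlo' := (hM (i + 1) (by omega)).1
    rcases hfilter _ _ (hφ (Nat.lt_succ_self i)) with hdec | hdec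
    · have : (1 - γh) * h (φ i) ≤ (1 - γh) * (L + γh * L / 2) :=
        mul_le_mul_of_nonneg_left hup.le (by linarith)
      nlinarith [mul_pos hγ0 hγL]
    · have : γℓ * (L / 2) ≤ γℓ * h (φ i) :=
        mul_le_mul_of_nonneg_left (by nlinarith) hγℓ.1.le
      linarith
  have hsum : ∀ n : ℕ, ℓ (φ (M + n)) ≤ ℓ (φ M) - n * (γℓ * (L / 2)) := by
    intro n
    induction n with
    | zero => simp
    | succ n ih =>
      have := hstep (M + n) (by omega)
      rw [← add_assoc]
      push_cast
      linarith
  obtain ⟨n, hn⟩ := exists_nat_gt ((ℓ (φ M) - ℓmin) / (γℓ * (L / 2)))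
  rw [div_lt_iff₀ hδ] at hn
  linarith [hsum n, hℓ (φ (M + n))]
end

section
/- Let E be the Euclidean space ℝⁿ with inner product ⟪·,·⟫ and norm ‖·‖. Let g ∈ E, let H : E → E be a continuous linear map, let σ > 0, and let ε > 0, M_H > 0 with ‖g‖ ≥ ε, ‖H‖ ≤ M_H, and σ ≥ (1 + M_H)²/(4ε). Suppose t ∈ E satisfies the Cauchy decrease condition −⟪g, t⟫ − (1/2)⟪t, H t⟫ − (σ/3)‖t‖³ ≥ (‖g‖/(6√2)) · min(‖g‖/(1 + ‖H‖), (1/2)√(‖g‖/σ)). Then −⟪g, t⟫ − (1/2)⟪t, H t⟫ − (σ/3)‖t‖³ ≥ (ε·√ε)/(12√2) · (1/√σ). -/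
open RealInnerProductSpace

/-- Once `σ ≥ (1 + M)² / (4ε)`, both candidate Cauchy step lengths are at least
`√(ε / σ) / 2`. -/
theorem half_sqrt_div_le_min {a b σ ε M : ℝ} (hσ : 0 < σ) (hε : 0 < ε) (hb : 0 ≤ b)
    (ha : ε ≤ a) (hbM : b ≤ M) (hσM : (1 + M) ^ 2 / (4 * ε) ≤ σ) :
    1 / 2 * Real.sqrt (ε / σ) ≤ min (a / (1 + b)) (1 / 2 * Real.sqrt (a / σ)) := by
  have hM : 0 < 1 + M := by linarith
  refine le_min ?_ (by gcongr)
  have hsqrt : Real.sqrt (ε / σ) ≤ 2 * ε / (1 + M) := by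
    refine Real.sqrt_le_iff.mpr ⟨by positivity, ?_⟩
    rw [div_le_iff₀ (by positivity)] at hσM
    rw [div_pow, div_le_div_iff₀ hσ (by positivity)]
    nlinarith [mul_le_mul_of_nonneg_left hσM hε.le]
  calc
    1 / 2 * Real.sqrt (ε / σ) ≤ 1 / 2 * (2 * ε / (1 + M)) := by gcongr
    _ = ε / (1 + M) := by ring
    _ ≤ a / (1 + b) := by gcongr; linarith

/-- Inequality (3.12) in the proof of Lemma 3.5: under `‖g‖ ≥ ε` and
`σ ≥ (1 + M_H)²/(4ε)`, the Cauchy decrease is at least `ε√ε/(12√2√σ)`. -/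
theorem model_decrease_lower_bound (n : ℕ) (g : EuclideanSpace ℝ (Fin n))
    (H : EuclideanSpace ℝ (Fin n) →L[ℝ] EuclideanSpace ℝ (Fin n))
    (σ ε M_H : ℝ) (hσ : 0 < σ) (hε : 0 < ε) (hMH : 0 < M_H)
    (hg : ε ≤ ‖g‖) (hH : ‖H‖ ≤ M_H)
    (hσbig : (1 + M_H)^2 / (4 * ε) ≤ σ)
    (t : EuclideanSpace ℝ (Fin n))
    (hdec : -⟪g, t⟫ - (1/2) * ⟪t, H t⟫ - (σ/3) * ‖t‖^3 ≥
      (‖g‖ / (6 * Real.sqrt 2)) *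
        min (‖g‖ / (1 + ‖H‖)) ((1/2) * Real.sqrt (‖g‖ / σ))) :
    -⟪g, t⟫ - (1/2) * ⟪t, H t⟫ - (σ/3) * ‖t‖^3 ≥
      (ε * Real.sqrt ε) / (12 * Real.sqrt 2) * (1 / Real.sqrt σ) := by
  refine le_trans ?_ hdec
  calc
    (ε * Real.sqrt ε) / (12 * Real.sqrt 2) * (1 / Real.sqrt σ)
        = ε / (6 * Real.sqrt 2) * (1 / 2 * Real.sqrt (ε / σ)) := by
      rw [Real.sqrt_div hε.le]
      ring
    _ ≤ ‖g‖ / (6 * Real.sqrt 2) *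
        min (‖g‖ / (1 + ‖H‖)) (1 / 2 * Real.sqrt (‖g‖ / σ)) := by
      gcongr
      exact half_sqrt_div_le_min hσ hε (norm_nonneg H) hg hH hσbig
end

section
/- Let E be the Euclidean space ℝⁿ with inner product ⟪·,·⟫ and norm ‖·‖. Let g, t ∈ E, let H : E → E be a continuous linear map with ⟪t, H t⟫ ≥ 0, let σ > 0, ε > 0, and let r ∈ ℝ. Define m(α) := α⟪g, t⟫ + (1/2)α²⟪t, H t⟫ + (1/3)α³σ‖t‖³ − α·r for α ∈ ℝ. If −⟪g, t⟫ − (1/2)⟪t, H t⟫ − (σ/3)‖t‖³ ≥ (ε√ε)/(12√2·√σ) and |r| ≤ (ε√ε)/(24√2·√σ), then for every α ∈ (0, 1], −m(α) ≥ α·(ε√ε)/(24√2·√σ). -/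
open RealInnerProductSpace

/-- Conclusion (3.11) of Lemma 3.5: lower bound on the line-search model decrease. -/
theorem line_search_model_decrease (n : ℕ) (g t : EuclideanSpace ℝ (Fin n))
    (H : EuclideanSpace ℝ (Fin n) →L[ℝ] EuclideanSpace ℝ (Fin n))
    (hpsd : 0 ≤ ⟪t, H t⟫) (σ ε r : ℝ) (hσ : 0 < σ) (hε : 0 < ε)
    (m : ℝ → ℝ)
    (hm : ∀ α : ℝ, m α = α * ⟪g, t⟫ + (1/2) * α^2 * ⟪t, H t⟫
      + (1/3) * α^3 * σ * ‖t‖^3 - α * r)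
    (hdec : -⟪g, t⟫ - (1/2) * ⟪t, H t⟫ - (σ/3) * ‖t‖^3 ≥
      (ε * Real.sqrt ε) / (12 * Real.sqrt 2 * Real.sqrt σ))
    (hr : |r| ≤ (ε * Real.sqrt ε) / (24 * Real.sqrt 2 * Real.sqrt σ)) :
    ∀ α : ℝ, α ∈ Set.Ioc (0:ℝ) 1 →
      -m α ≥ α * ((ε * Real.sqrt ε) / (24 * Real.sqrt 2 * Real.sqrt σ)) := by
  rintro α ⟨hα0, hα1⟩
  have hhalf : (ε * Real.sqrt ε) / (12 * Real.sqrt 2 * Real.sqrt σ)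
      = 2 * ((ε * Real.sqrt ε) / (24 * Real.sqrt 2 * Real.sqrt σ)) := by
    have h2 : Real.sqrt 2 ≠ 0 := by positivity
    have hs : Real.sqrt σ ≠ 0 := by positivity
    field_simp
    norm_num
  rw [hhalf] at hdec
  rw [hm]
  have hcube : 0 ≤ σ * ‖t‖ ^ 3 := by positivity
  generalize (ε * Real.sqrt ε) / (24 * Real.sqrt 2 * Real.sqrt σ) = K at *
  have hquad : α * ⟪t, H t⟫ ≤ ⟪t, H t⟫ := mul_le_of_le_one_left hpsd hα1
  have hcubic : α ^ 2 * (σ * ‖t‖ ^ 3) ≤ σ * ‖t‖ ^ 3 :=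
    mul_le_of_le_one_left hcube (pow_le_one₀ hα0.le hα1)
  have hslope : K ≤ -⟪g, t⟫ - (1/2) * (α * ⟪t, H t⟫)
      - (1/3) * (α ^ 2 * (σ * ‖t‖ ^ 3)) + r := by
    linarith [neg_le_of_abs_le hr]
  have hscaled := mul_le_mul_of_nonneg_left hslope hα0.le
  linarith
end

section
/- Let η ∈ (0,1), M_ℓ > 0, ε > 0, σ > 0, α ∈ (0,1], and let m < 0 and D ∈ ℝ be real numbers (D plays the role of ℓ(x+αd) − ℓ(x)). Suppose D − m ≤ M_ℓ·α²/σ, −m ≥ α·(ε√ε)/(24√2·√σ), and σ ≥ (24√2·M_ℓ/((1−η)·ε√ε))². Then D/m ≥ η. -/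
/-- Lemma 3.7 (abstract form): if the regularization parameter is large enough,
the reduction ratio `ρ = D/m` is at least `η`. -/
theorem ratio_ge_eta (η M_ℓ ε σ α m D : ℝ)
    (hη : η ∈ Set.Ioo (0:ℝ) 1) (hMℓ : 0 < M_ℓ) (hε : 0 < ε) (hσ : 0 < σ)
    (hα : α ∈ Set.Ioc (0:ℝ) 1) (hm : m < 0)
    (htaylor : D - m ≤ M_ℓ * α^2 / σ)
    (hdec : -m ≥ α * (ε * Real.sqrt ε) / (24 * Real.sqrt 2 * Real.sqrt σ))
    (hσbig : σ ≥ (24 * Real.sqrt 2 * M_ℓ / ((1 - η) * (ε * Real.sqrt ε)))^2) :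
    D / m ≥ η := by
  obtain ⟨-, hη1⟩ := hη
  obtain ⟨hα0, hα1⟩ := hα
  have hη' : 0 < 1 - η := sub_pos.2 hη1
  have he : 0 < ε * Real.sqrt ε := by positivity
  have hc : 0 < 24 * Real.sqrt 2 := by positivity
  have hs : 0 < Real.sqrt σ := Real.sqrt_pos.2 hσ
  have hsq : Real.sqrt σ ^ 2 = σ := Real.sq_sqrt hσ.le
  have hroot := Real.le_sqrt_of_sq_le hσbig
  generalize ε * Real.sqrt ε = e at *
  generalize 24 * Real.sqrt 2 = c at *
  generalize Real.sqrt σ = s at *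
  subst hsq
  rw [div_le_iff₀ (by positivity)] at hroot
  have hbound : M_ℓ * α ^ 2 / s ^ 2 ≤ (1 - η) * (α * e / (c * s)) :=
    calc M_ℓ * α ^ 2 / s ^ 2 = c * M_ℓ * (α * α) / (c * s ^ 2) := by field_simp
      _ ≤ s * ((1 - η) * e) * (α * 1) / (c * s ^ 2) := by gcongr
      _ = (1 - η) * (α * e / (c * s)) := by field_simp
  have hmodel := mul_le_mul_of_nonneg_left hdec hη'.le
  rw [ge_iff_le, le_div_iff_of_neg hm]
  linarith
end

section
/- Let μ ∈ (0,1), M_ℓ > 0, ε > 0, σ_min > 0, and set ᾱ := (1−μ)·ε√ε·√σ_min/(24√2·M_ℓ). Let σ ≥ σ_min, α ∈ (0, ᾱ] with α ≤ 1, and let m, D ∈ ℝ satisfy D − m ≤ M_ℓ·α²/σ and −m ≥ α·(ε√ε)/(24√2·√σ). Then D ≤ μ·m. -/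
/-- Lemma 3.8 (abstract form): the Armijo-type sufficient decrease condition
holds for all step sizes `α ≤ ᾱ`. -/
theorem armijo_for_small_steps (μ M_ℓ ε σmin : ℝ)
    (hμ : μ ∈ Set.Ioo (0:ℝ) 1) (hMℓ : 0 < M_ℓ) (hε : 0 < ε) (hσmin : 0 < σmin)
    (αbar : ℝ)
    (hαbar : αbar = (1 - μ) * (ε * Real.sqrt ε) * Real.sqrt σmin / (24 * Real.sqrt 2 * M_ℓ))
    (σ α m D : ℝ) (hσ : σmin ≤ σ) (hα : α ∈ Set.Ioc (0:ℝ) αbar) (hα1 : α ≤ 1)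
    (htaylor : D - m ≤ M_ℓ * α^2 / σ)
    (hdec : -m ≥ α * (ε * Real.sqrt ε) / (24 * Real.sqrt 2 * Real.sqrt σ)) :
    D ≤ μ * m := by
  obtain ⟨-, hμ1⟩ := hμ
  obtain ⟨hα0, hαle⟩ := hα
  have hσ0 : 0 < σ := hσmin.trans_le hσ
  have hs : 0 < Real.sqrt σ := Real.sqrt_pos.2 hσ0
  have hstep : α * (24 * Real.sqrt 2 * M_ℓ) ≤ (1 - μ) * (ε * Real.sqrt ε) * Real.sqrt σ := by
    rw [hαbar, le_div_iff₀ (by positivity)] at hαle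
    refine hαle.trans (mul_le_mul_of_nonneg_left (Real.sqrt_le_sqrt hσ) ?_)
    exact mul_nonneg (sub_nonneg.2 hμ1.le) (by positivity)
  have hbound : M_ℓ * α ^ 2 / σ ≤
      (1 - μ) * (α * (ε * Real.sqrt ε) / (24 * Real.sqrt 2 * Real.sqrt σ)) := by
    rw [← mul_div_assoc, div_le_div_iff₀ hσ0 (by positivity)]
    calc M_ℓ * α ^ 2 * (24 * Real.sqrt 2 * Real.sqrt σ)
        = α * (24 * Real.sqrt 2 * M_ℓ) * (α * Real.sqrt σ) := by ring
      _ ≤ (1 - μ) * (ε * Real.sqrt ε) * Real.sqrt σ * (α * Real.sqrt σ) :=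
          mul_le_mul_of_nonneg_right hstep (by positivity)
      _ = (1 - μ) * (α * (ε * Real.sqrt ε)) * (Real.sqrt σ * Real.sqrt σ) := by ring
      _ = (1 - μ) * (α * (ε * Real.sqrt ε)) * σ := by rw [Real.mul_self_sqrt hσ0.le]
  have hmodel := mul_le_mul_of_nonneg_left hdec (sub_nonneg.2 hμ1.le)
  linarith
end
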